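/- arXiv:1812.11599 — 10 statements merged into one kernel-verified Lean document; each statement's English description precedes it below -/
import Mathlib

section
/- Let c_1,…,c_t and k ≥ 1 be integers and let p be a prime that divides none of c_1,…,c_t. Let s be the largest nonnegative integer with p^s dividing k. Suppose n ≥ 2s+1 and there exist integers m_1,…,m_t, at least one of which is not divisible by p, and an integer a with c_1·m_1^k + c_2·m_2^k + ⋯ + c_t·m_t^k ≡ a (mod p^n). Then for every integer j with 0 ≤ j < p there exist integers x_1,…,x_t with c_1·x_1^k + ⋯ + c_t·x_t^k ≡ a + j·p^n (mod p^{n+1}). -/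
/-- lifting representations for `c₁x₁^k + ⋯ + c_t x_t^k`
from modulus `pⁿ` to modulus `pⁿ⁺¹`. -/
theorem lift_representation (t k : ℕ) (hk : 1 ≤ k) (c : Fin t → ℤ)
    (p : ℕ) (hp : p.Prime) (hc : ∀ i, ¬ (p : ℤ) ∣ c i)
    (s : ℕ) (hs : p ^ s ∣ k ∧ ¬ p ^ (s + 1) ∣ k)
    (n : ℕ) (hn : 2 * s + 1 ≤ n)
    (m : Fin t → ℤ) (hm : ∃ i, ¬ (p : ℤ) ∣ m i)
    (a : ℤ) (ha : (∑ i, c i * m i ^ k) ≡ a [ZMOD ((p : ℤ) ^ n)]) :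
    ∀ j : ℕ, j < p → ∃ x : Fin t → ℤ,
      (∑ i, c i * x i ^ k) ≡ a + (j : ℤ) * (p : ℤ) ^ n [ZMOD ((p : ℤ) ^ (n + 1))] := by
  intro j _
  obtain ⟨i₀, hi₀⟩ := hm
  obtain ⟨⟨u, hu⟩, hs2⟩ := hs
  have hpz : Prime (p : ℤ) := Nat.prime_iff_prime_int.mp hp
  have hpu : ¬ (p : ℤ) ∣ (u : ℤ) := by
    intro h
    have h' : p ∣ u := by exact_mod_cast h
    obtain ⟨v, hv⟩ := h'
    exact hs2 ⟨v, by rw [hu, hv, pow_succ, mul_assoc]⟩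
  have hd : ¬ (p : ℤ) ∣ c i₀ * (u * m i₀ ^ (k - 1)) := by
    intro h
    rcases hpz.dvd_or_dvd h with h | h
    · exact hc _ h
    · rcases hpz.dvd_or_dvd h with h | h
      · exact hpu h
      · exact hi₀ (hpz.dvd_of_dvd_pow h)
  obtain ⟨f, e, hfe⟩ := (hpz.coprime_iff_not_dvd).2 hd
  obtain ⟨q, hq⟩ := ha.dvd
  obtain ⟨r, hr⟩ : ∃ r, n = 2 * s + 1 + r := ⟨_, (Nat.add_sub_of_le hn).symm⟩
  obtain ⟨E, hE⟩ := Polynomial.powAddExpansion (m i₀)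
    (e * (q + j) * (p : ℤ) ^ (s + 1 + r)) k
  refine ⟨Function.update m i₀ (m i₀ + e * (q + j) * (p : ℤ) ^ (s + 1 + r)), ?_⟩
  have hsum : (∑ i, c i * (Function.update m i₀
      (m i₀ + e * (q + j) * (p : ℤ) ^ (s + 1 + r)) i) ^ k)
      = (∑ i, c i * m i ^ k) + c i₀ * ((m i₀ + e * (q + j) * (p : ℤ) ^ (s + 1 + r)) ^ k
        - m i₀ ^ k) := by
    rw [← sub_eq_iff_eq_add', ← Finset.sum_sub_distrib, Finset.sum_eq_single i₀]
    · simp [mul_sub]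
    · intro b _ hb
      simp [hb]
    · simp
  have hku : (k : ℤ) = (p : ℤ) ^ s * u := by exact_mod_cast hu
  rw [hsum, hE, Int.modEq_comm, Int.modEq_iff_dvd]
  refine ⟨-(f * (q + j)) + c i₀ * E * (e * (q + j)) ^ 2 * (p : ℤ) ^ r, ?_⟩
  have ha' : a = (∑ i, c i * m i ^ k) + (p : ℤ) ^ n * q := by linarith
  rw [ha', hku, hr]
  have h1 : (p : ℤ) ^ (2 * s + 1 + r) = (p : ℤ) ^ s * (p : ℤ) ^ (s + 1 + r) := by ring
  linear_combination ((p : ℤ) ^ (2 * s + 1 + r) * (q + j)) * hfe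
end

section
/- Let c_1,…,c_t and k ≥ 1 be integers, let p be a prime dividing none of c_1,…,c_t, and let n > k+1. If b ∈ {0,1,…,p^n−1} is such that the residue of b mod p^{n−1} is representable mod p^{n−1} but b is not representable mod p^n, then b = p^k·a for some a ∈ {0,1,…,p^{n−k}−1} whose residue mod p^{n−k−1} is representable mod p^{n−k−1} but which is not representable mod p^{n−k}. In other words, N_{p^n} ⊆ p^k·N_{p^{n−k}}. -/
lemma pow_step (p : ℕ) (r : ℕ) (hr : 2 ≤ r) (x y : ℤ) (m : ℕ) (s : ℕ) :
    ∃ z : ℤ, (x + (p:ℤ) ^ r * y) ^ (p ^ s * m)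
      = x ^ (p ^ s * m) + ((p:ℤ) ^ (r + s) * (m * x ^ (p ^ s * m - 1) * y))
        + (p:ℤ) ^ (r + s + 1) * z := by
  induction s with
  | zero =>
    obtain ⟨q, hq⟩ := Polynomial.powAddExpansion x ((p:ℤ) ^ r * y) m
    obtain ⟨d, rfl⟩ := Nat.exists_eq_add_of_le hr
    refine ⟨q * (p:ℤ) ^ (d + 1) * y ^ 2, ?_⟩
    simp only [pow_zero, one_mul, add_zero]
    rw [hq]
    ring
  | succ s ih =>
    obtain ⟨z, hz⟩ := ih
    set k := p ^ s * m with hk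
    have e : p ^ (s + 1) * m = k * p := by rw [hk]; ring
    obtain ⟨q, hq⟩ := Polynomial.powAddExpansion (x ^ k)
      ((p:ℤ) ^ (r + s) * (m * x ^ (k - 1) * y) + (p:ℤ) ^ (r + s + 1) * z) p
    obtain ⟨d, rfl⟩ := Nat.exists_eq_add_of_le hr
    refine ⟨(x ^ k) ^ (p - 1) * z + q * (p:ℤ) ^ (d + s) * (m * x ^ (k - 1) * y + p * z) ^ 2, ?_⟩
    rw [e, pow_mul, hz, add_assoc, hq, pow_mul]
    rcases Nat.eq_zero_or_pos k with h0 | h0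
    · rcases Nat.eq_zero_or_pos m with hm | hm
      · subst hm
        simp only [h0]
        push_cast
        ring
      · have hp0 : p = 0 := by
          by_contra h
          have : 0 < p ^ s * m := Nat.mul_pos (Nat.pow_pos (Nat.pos_of_ne_zero h)) hm
          omega
        subst hp0
        simp [h0]
    · rcases Nat.eq_zero_or_pos p with hp0 | hp0
      · subst hp0
        simp
      · have e2 : x ^ (k * p - 1) = (x ^ k) ^ (p - 1) * x ^ (k - 1) := by
          rw [← pow_mul, ← pow_add]
          congr 1
          have h1 : k ≤ k * p := Nat.le_mul_of_pos_right k hp0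
          rw [Nat.mul_sub, mul_one]
          omega
        rw [e2]
        ring


/-- `N_{pⁿ} ⊆ p^k · N_{p^{n−k}}` for `n > k + 1`, for the
polynomial `c₁x₁^k + ⋯ + c_t x_t^k` with `p` dividing none of the `cᵢ`. -/
theorem Nset_subset (t k : ℕ) (hk : 1 ≤ k) (c : Fin t → ℤ)
    (p : ℕ) (hp : p.Prime) (hc : ∀ i, ¬ (p : ℤ) ∣ c i)
    (n : ℕ) (hn : k + 1 < n)
    (b : ℕ) (hb : b < p ^ n)
    (hb1 : ∃ x : Fin t → ℤ,
      (∑ i, c i * x i ^ k) ≡ ((b % p ^ (n - 1) : ℕ) : ℤ) [ZMOD ((p : ℤ) ^ (n - 1))])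
    (hb2 : ¬ ∃ x : Fin t → ℤ, (∑ i, c i * x i ^ k) ≡ (b : ℤ) [ZMOD ((p : ℤ) ^ n)]) :
    ∃ a : ℕ, a < p ^ (n - k) ∧
      (∃ x : Fin t → ℤ,
        (∑ i, c i * x i ^ k) ≡ ((a % p ^ (n - k - 1) : ℕ) : ℤ) [ZMOD ((p : ℤ) ^ (n - k - 1))]) ∧
      (¬ ∃ x : Fin t → ℤ, (∑ i, c i * x i ^ k) ≡ (a : ℤ) [ZMOD ((p : ℤ) ^ (n - k))]) ∧
      b = p ^ k * a := by
  have hpp : Prime (p : ℤ) := Nat.prime_iff_prime_int.mp hp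
  have hp0 : (p : ℤ) ≠ 0 := hpp.ne_zero
  obtain ⟨x, hx⟩ := hb1
  have hx' : (p : ℤ) ^ (n - 1) ∣ (b : ℤ) - ∑ i, c i * x i ^ k := by
    apply Int.ModEq.dvd
    refine hx.trans ?_
    push_cast
    exact Int.mod_modEq _ _
  by_cases hall : ∀ i, (p : ℤ) ∣ x i
  · choose z hz using hall
    have hf : ∀ y : Fin t → ℤ, ∑ i, c i * ((p:ℤ) * y i) ^ k = (p:ℤ) ^ k * ∑ i, c i * y i ^ k := by
      intro y
      rw [Finset.mul_sum]
      exact Finset.sum_congr rfl fun i _ => by ring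
    have hfx : ∑ i, c i * x i ^ k = (p:ℤ) ^ k * ∑ i, c i * z i ^ k := by
      rw [← hf]
      exact Finset.sum_congr rfl fun i _ => by rw [hz i]
    rw [hfx] at hx'
    have hkb : (p : ℤ) ^ k ∣ b := by
      have h1 := (pow_dvd_pow (p:ℤ) (show k ≤ n - 1 by omega)).trans hx'
      exact (dvd_sub_left (dvd_mul_right _ _)).mp h1
    have hkb' : p ^ k ∣ b := by exact_mod_cast hkb
    obtain ⟨a, rfl⟩ := hkb'
    have e1 : n - 1 = k + (n - k - 1) := by omega
    have e2 : n = k + (n - k) := by omega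
    refine ⟨a, ?_, ⟨z, ?_⟩, ?_, rfl⟩
    · rw [e2, pow_add] at hb
      simpa using lt_of_mul_lt_mul_left hb (Nat.zero_le _)
    · rw [e1, pow_add] at hx'
      push_cast at hx' ⊢
      rw [← mul_sub] at hx'
      have h2 := (mul_dvd_mul_iff_left (pow_ne_zero k hp0)).mp hx'
      exact (Int.modEq_iff_dvd.mpr h2).trans (Int.mod_modEq _ _).symm
    · rintro ⟨y, hy⟩
      apply hb2
      refine ⟨fun i => p * y i, ?_⟩
      rw [hf, Int.modEq_iff_dvd]
      push_cast
      rw [← mul_sub]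
      have h3 := mul_dvd_mul_left ((p:ℤ) ^ k) hy.dvd
      rwa [← pow_add, ← e2] at h3
  · exfalso
    push Not at hall
    obtain ⟨i, hi⟩ := hall
    obtain ⟨s, m, hm, hkm⟩ := Nat.exists_eq_pow_mul_and_not_dvd (show k ≠ 0 by omega) p hp.ne_one
    have hsk : s < k := by
      have h1 : s < p ^ s := Nat.lt_pow_self hp.one_lt
      have h2 : p ^ s ≤ k := Nat.le_of_dvd hk ⟨m, hkm⟩
      omega
    obtain ⟨w, hw⟩ := hx'
    have hcop : IsCoprime (c i * (m * x i ^ (k - 1))) (p : ℤ) := by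
      rw [isCoprime_comm, hpp.coprime_iff_not_dvd]
      intro h
      rcases hpp.dvd_or_dvd h with h | h
      · exact hc i h
      · rcases hpp.dvd_or_dvd h with h | h
        · exact hm (by exact_mod_cast h)
        · exact hi (hpp.dvd_of_dvd_pow h)
    obtain ⟨u, v, huv⟩ := hcop
    obtain ⟨z, hz⟩ := pow_step p (n - 1 - s) (by omega) (x i) (u * w) m s
    rw [← hkm, show n - 1 - s + s = n - 1 by omega, show n - 1 + 1 = n by omega] at hz
    apply hb2
    refine ⟨Function.update x i (x i + (p:ℤ) ^ (n - 1 - s) * (u * w)), ?_⟩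
    rw [Int.modEq_iff_dvd]
    have hsum : ∑ j, c j * (Function.update x i (x i + (p:ℤ) ^ (n - 1 - s) * (u * w))) j ^ k
        = ∑ j, c j * x j ^ k
          + c i * ((x i + (p:ℤ) ^ (n - 1 - s) * (u * w)) ^ k - x i ^ k) := by
      rw [← Finset.add_sum_erase _ _ (Finset.mem_univ i),
        ← Finset.add_sum_erase _ (fun j => c j * x j ^ k) (Finset.mem_univ i)]
      rw [Finset.sum_congr rfl (fun j hj => by
        rw [Function.update_of_ne (Finset.ne_of_mem_erase hj)] :
        ∀ j ∈ Finset.univ.erase i, _ = c j * x j ^ k)]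
      simp only [Function.update_self]
      ring
    rw [hsum, hz]
    have en : (p:ℤ) ^ n = (p:ℤ) ^ (n - 1) * p := by
      rw [← pow_succ]
      congr 1
      omega
    refine ⟨w * v - c i * z, ?_⟩
    rw [en]
    linear_combination hw - (p:ℤ) ^ (n - 1) * w * huv
end

section
/- Let f(x_1,…,x_t) = c_1·x_1^k + ⋯ + c_t·x_t^k with integer coefficients and k ≥ 1, let p be a prime dividing none of c_1,…,c_t, and suppose some exponent e of p in f divides k. Then for every n > k, if a ∈ {0,1,…,p^{n−k}−1} has its residue mod p^{n−k−1} representable mod p^{n−k−1} but a is not representable mod p^{n−k}, then p^k·a has its residue mod p^{n−1} representable mod p^{n−1} but p^k·a is not representable mod p^n. In other words, p^k·N_{p^{n−k}} ⊆ N_{p^n}. -/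
theorem exp_iter (t k : ℕ) (c : Fin t → ℤ) (p : ℕ) (hp : p.Prime) (e : ℕ)
    (hexp : ∀ m : Fin t → ℤ, (p : ℤ) ^ e ∣ (∑ i, c i * m i ^ k) →
      ∃ q : Fin t → ℤ, (∑ i, c i * m i ^ k) = (p : ℤ) ^ e * ∑ i, c i * q i ^ k)
    (j : ℕ) : ∀ m : Fin t → ℤ, (p : ℤ) ^ (e * j) ∣ (∑ i, c i * m i ^ k) →
      ∃ q : Fin t → ℤ, (∑ i, c i * m i ^ k) = (p : ℤ) ^ (e * j) * ∑ i, c i * q i ^ k := by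
  have hp0 : (p : ℤ) ≠ 0 := by exact_mod_cast hp.ne_zero
  induction j with
  | zero => intro m _; exact ⟨m, by simp⟩
  | succ j ih =>
    intro m hm
    rw [Nat.mul_succ, pow_add] at hm
    obtain ⟨q, hq⟩ := ih m (dvd_trans (dvd_mul_right _ _) hm)
    rw [hq] at hm
    obtain ⟨r, hr⟩ := hexp q ((mul_dvd_mul_iff_left (pow_ne_zero _ hp0)).1 hm)
    exact ⟨r, by rw [hq, hr, Nat.mul_succ, pow_add, mul_assoc]⟩

/-- `p^k · N_{p^{n−k}} ⊆ N_{pⁿ}` for `n > k`, provided some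
exponent `e` of `p` in `c₁x₁^k + ⋯ + c_t x_t^k` divides `k`. -/
theorem Nset_supset (t k : ℕ) (hk : 1 ≤ k) (c : Fin t → ℤ)
    (p : ℕ) (hp : p.Prime) (hc : ∀ i, ¬ (p : ℤ) ∣ c i)
    (e : ℕ) (he : e ∣ k)
    (hexp : ∀ m : Fin t → ℤ, (p : ℤ) ^ e ∣ (∑ i, c i * m i ^ k) →
      ∃ q : Fin t → ℤ, (∑ i, c i * m i ^ k) = (p : ℤ) ^ e * ∑ i, c i * q i ^ k)
    (n : ℕ) (hn : k < n)
    (a : ℕ) (ha : a < p ^ (n - k))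
    (ha1 : ∃ x : Fin t → ℤ,
      (∑ i, c i * x i ^ k) ≡ ((a % p ^ (n - k - 1) : ℕ) : ℤ) [ZMOD ((p : ℤ) ^ (n - k - 1))])
    (ha2 : ¬ ∃ x : Fin t → ℤ, (∑ i, c i * x i ^ k) ≡ (a : ℤ) [ZMOD ((p : ℤ) ^ (n - k))]) :
    p ^ k * a < p ^ n ∧
      (∃ x : Fin t → ℤ,
        (∑ i, c i * x i ^ k) ≡ ((p ^ k * a % p ^ (n - 1) : ℕ) : ℤ) [ZMOD ((p : ℤ) ^ (n - 1))]) ∧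
      ¬ ∃ x : Fin t → ℤ,
        (∑ i, c i * x i ^ k) ≡ ((p ^ k * a : ℕ) : ℤ) [ZMOD ((p : ℤ) ^ n)] := by
  have hp0 : (p : ℤ) ≠ 0 := by exact_mod_cast hp.ne_zero
  have hpk : (p : ℤ) ^ k ≠ 0 := pow_ne_zero _ hp0
  have hN : n = k + (n - k) := by omega
  have hN1 : n - 1 = k + (n - k - 1) := by omega
  refine ⟨?_, ?_, ?_⟩
  · rw [hN, pow_add]
    simpa using Nat.mul_lt_mul_of_pos_left ha (pow_pos hp.pos k)
  · obtain ⟨x, hx⟩ := ha1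
    refine ⟨fun i => p * x i, ?_⟩
    have h1 : (∑ i, c i * ((p : ℤ) * x i) ^ k) = (p : ℤ) ^ k * ∑ i, c i * x i ^ k := by
      rw [Finset.mul_sum]
      refine Finset.sum_congr rfl fun i _ => ?_
      rw [mul_pow]; ring
    have h2 : p ^ k * a % p ^ (n - 1) = p ^ k * (a % p ^ (n - k - 1)) := by
      rw [hN1, pow_add, Nat.mul_mod_mul_left]
    rw [h1, h2, hN1, pow_add, Nat.cast_mul, Nat.cast_pow]
    exact hx.mul_left'
  · rintro ⟨x, hx⟩
    have hd := hx.symm.dvd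
    rw [hN, pow_add, Nat.cast_mul, Nat.cast_pow] at hd
    have hdk : (p : ℤ) ^ k ∣ ∑ i, c i * x i ^ k :=
      (dvd_sub_left (dvd_mul_right _ _)).1 (dvd_trans (dvd_mul_right _ _) hd)
    obtain ⟨j, hj⟩ := he
    have hit := exp_iter t k c p hp e hexp j x
    rw [← hj] at hit
    obtain ⟨q, hq⟩ := hit hdk
    refine ha2 ⟨q, ?_⟩
    rw [hq, ← mul_sub] at hd
    exact (Int.modEq_iff_dvd.2 ((mul_dvd_mul_iff_left hpk).1 hd)).symm
end

section
/- Let k ≥ 1 and let p be a prime that does not divide k, and set d = gcd(k, p−1). For n ≥ 1 write n ≡ r (mod k) with 1 ≤ r ≤ k. Then the number of residues a ∈ {0,1,…,p^n−1} such that the congruence x^k ≡ a (mod p^n) is solvable equals (p^{n+k−1} − p^{r−1})·(p−1)/(d·(p^k−1)) + 1. -/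
/-- the set of `k`-th power residues mod `p^n` -/
def powRes (k p n : ℕ) : Set ℕ :=
  {a : ℕ | a < p ^ n ∧ ∃ x : ℤ, x ^ k ≡ (a : ℤ) [ZMOD ((p : ℤ) ^ n)]}

lemma powRes_finite (k p n : ℕ) : (powRes k p n).Finite :=
  (Set.finite_lt_nat (p ^ n)).subset fun _ h => h.1

lemma card_range_units (k p n : ℕ) (hp : p.Prime) (hpk : ¬ p ∣ k) (hn : 1 ≤ n) :
    Nat.card (powMonoidHom k : (ZMod (p ^ n))ˣ →* (ZMod (p ^ n))ˣ).range * Nat.gcd k (p - 1)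
      = p ^ (n - 1) * (p - 1) := by
  have : NeZero (p ^ n) := ⟨pow_ne_zero _ hp.ne_zero⟩
  have hcard : Nat.card (ZMod (p ^ n))ˣ = p ^ (n - 1) * (p - 1) := by
    rw [Nat.card_eq_fintype_card, ZMod.card_units_eq_totient, Nat.totient_prime_pow hp hn]
  have hcop : Nat.Coprime k (p ^ (n - 1)) :=
    (Nat.Coprime.pow_left _ ((Nat.Prime.coprime_iff_not_dvd hp).2 hpk)).symm
  have hgcd : Nat.gcd k (p ^ (n - 1) * (p - 1)) = Nat.gcd k (p - 1) :=
    Nat.Coprime.gcd_mul_left_cancel_right _ hcop.symm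
  rcases hp.eq_two_or_odd' with h2 | ho
  · subst h2
    have hc : (Nat.card (ZMod (2 ^ n))ˣ).Coprime k := by
      rw [hcard, Nat.coprime_comm]; simpa using hcop
    have : (powMonoidHom k : (ZMod (2 ^ n))ˣ →* (ZMod (2 ^ n))ˣ).range = ⊤ := by
      rw [MonoidHom.range_eq_top]
      exact (powCoprime hc).surjective
    rw [this, Subgroup.card_top, hcard]; simp
  · have : IsCyclic (ZMod (p ^ n))ˣ := ZMod.isCyclic_units_of_prime_pow p hp (by rintro rfl; revert ho; decide) n
    rw [IsCyclic.card_powMonoidHom_range, hcard, Nat.gcd_comm, hgcd]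
    exact Nat.div_mul_cancel ((Nat.gcd_dvd_right _ _).mul_left _)

lemma mem_powRes_iff (k p n a : ℕ) :
    a ∈ powRes k p n ↔ a < p ^ n ∧ ∃ x : ZMod (p ^ n), x ^ k = a := by
  have key : ∀ x : ℤ, x ^ k ≡ (a : ℤ) [ZMOD ((p : ℤ) ^ n)] ↔ ((x : ZMod (p ^ n)) ^ k = a) := by
    intro x
    have := ZMod.intCast_eq_intCast_iff (x ^ k) a (p ^ n)
    push_cast at this
    exact this.symm
  unfold powRes
  simp only [Set.mem_ofPred_eq, key]
  refine and_congr_right fun _ => ⟨fun ⟨x, h⟩ => ⟨x, h⟩, fun ⟨x, h⟩ => ?_⟩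
  obtain ⟨y, rfl⟩ := ZMod.intCast_surjective x
  exact ⟨y, h⟩

lemma card_units_part (k p n : ℕ) (hk : 1 ≤ k) (hp : p.Prime) (hpk : ¬ p ∣ k) (hn : 1 ≤ n) :
    Set.ncard (powRes k p n ∩ {a | ¬ p ∣ a}) * Nat.gcd k (p - 1) = p ^ (n - 1) * (p - 1) := by
  have : NeZero (p ^ n) := ⟨pow_ne_zero _ hp.ne_zero⟩
  rw [← card_range_units k p n hp hpk hn]
  congr 1
  have : powRes k p n ∩ {a | ¬ p ∣ a} = (fun u : (ZMod (p ^ n))ˣ => (u : ZMod (p ^ n)).val) ''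
      ((powMonoidHom k : (ZMod (p ^ n))ˣ →* (ZMod (p ^ n))ˣ).range : Set _) := by
    ext a
    simp only [Set.mem_inter_iff, mem_powRes_iff, Set.mem_ofPred_eq, Set.mem_image, SetLike.mem_coe,
      MonoidHom.mem_range, powMonoidHom_apply]
    constructor
    · rintro ⟨⟨ha, x, hx⟩, hpa⟩
      have hu : IsUnit ((a : ZMod (p ^ n))) := by
        rw [ZMod.isUnit_iff_coprime]
        exact (Nat.Coprime.pow_left _ ((Nat.Prime.coprime_iff_not_dvd hp).2 hpa)).symm
      have hxu : IsUnit x := by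
        rw [← hx] at hu
        exact (isUnit_pow_iff (by omega)).1 hu
      obtain ⟨u, rfl⟩ := hxu
      refine ⟨u ^ k, ⟨u, rfl⟩, ?_⟩
      rw [Units.val_pow_eq_pow_val, hx, ZMod.val_natCast_of_lt ha]
    · rintro ⟨_, ⟨u, rfl⟩, rfl⟩
      refine ⟨⟨ZMod.val_lt _, u, ?_⟩, ?_⟩
      · rw [ZMod.natCast_zmod_val, Units.val_pow_eq_pow_val]
      · have := ZMod.val_coe_unit_coprime (u ^ k)
        rw [Nat.coprime_pow_right_iff (by omega), Nat.coprime_comm,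
          Nat.Prime.coprime_iff_not_dvd hp] at this
        exact this
  rw [this, Set.ncard_image_of_injective]
  · rfl
  · exact (ZMod.val_injective _).comp Units.val_injective

lemma nonunit_small (k p n : ℕ) (hk : 1 ≤ k) (hp : p.Prime) (hn : 1 ≤ n) (hnk : n ≤ k) :
    powRes k p n ∩ {a | p ∣ a} = {0} := by
  ext a
  simp only [powRes, Set.mem_inter_iff, Set.mem_ofPred_eq, Set.mem_singleton_iff]
  constructor
  · rintro ⟨⟨ha, x, hx⟩, hpa⟩
    have hpx : (p : ℤ) ∣ x := by
      apply (Nat.prime_iff_prime_int.1 hp).dvd_of_dvd_pow (n := k)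
      have h1 := hx.of_dvd (dvd_pow_self (p : ℤ) (by omega : n ≠ 0))
      exact (h1.dvd_iff).2 (by exact_mod_cast hpa)
    have h2 : ((p : ℤ) ^ n) ∣ x ^ k := (pow_dvd_pow _ hnk).trans (pow_dvd_pow_of_dvd hpx k)
    have h3 := (hx.dvd_iff).1 h2
    exact Nat.eq_zero_of_dvd_of_lt (by exact_mod_cast h3) ha
  · rintro rfl
    refine ⟨⟨pow_pos hp.pos _, 0, ?_⟩, dvd_zero _⟩
    rw [zero_pow (by omega)]; rfl

lemma nonunit_large (k p m : ℕ) (hk : 1 ≤ k) (hp : p.Prime) (hm : 1 ≤ m) :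
    powRes k p (m + k) ∩ {a | p ∣ a} = (fun b => p ^ k * b) '' powRes k p m := by
  have hp0 : (p : ℤ) ^ k ≠ 0 := pow_ne_zero _ (by exact_mod_cast hp.ne_zero)
  ext a
  simp only [powRes, Set.mem_inter_iff, Set.mem_ofPred_eq, Set.mem_image]
  constructor
  · rintro ⟨⟨ha, x, hx⟩, hpa⟩
    have hpx : (p : ℤ) ∣ x := by
      apply (Nat.prime_iff_prime_int.1 hp).dvd_of_dvd_pow (n := k)
      have h1 := hx.of_dvd (dvd_pow_self (p : ℤ) (by omega : m + k ≠ 0))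
      exact (h1.dvd_iff).2 (by exact_mod_cast hpa)
    have h2 : ((p : ℤ) ^ k) ∣ x ^ k := pow_dvd_pow_of_dvd hpx k
    have h3 := ((hx.of_dvd (pow_dvd_pow (p : ℤ) (by omega : k ≤ m + k))).dvd_iff).1 h2
    obtain ⟨b, rfl⟩ : p ^ k ∣ a := by exact_mod_cast h3
    obtain ⟨y, rfl⟩ := hpx
    refine ⟨b, ⟨?_, y, ?_⟩, rfl⟩
    · rw [pow_add, mul_comm] at ha
      exact lt_of_mul_lt_mul_right (by linarith) (Nat.zero_le (p ^ k))
    · push_cast at hx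
      rw [mul_pow, pow_add, mul_comm ((p : ℤ) ^ m)] at hx
      rw [Int.modEq_iff_dvd] at hx ⊢
      rw [← mul_sub] at hx
      exact (mul_dvd_mul_iff_left hp0).1 hx
  · rintro ⟨b, ⟨hb, y, hy⟩, rfl⟩
    refine ⟨⟨?_, p * y, ?_⟩, (dvd_pow_self p (by omega)).mul_right _⟩
    · rw [pow_add, mul_comm]
      exact Nat.mul_lt_mul_of_pos_right hb (pow_pos hp.pos _)
    · push_cast
      rw [mul_pow, pow_add, mul_comm ((p : ℤ) ^ m)]
      rw [Int.modEq_iff_dvd] at hy ⊢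
      rw [← mul_sub]
      exact mul_dvd_mul_left _ hy

lemma ncard_split (k p n : ℕ) : (powRes k p n).ncard =
    (powRes k p n ∩ {a | ¬ p ∣ a}).ncard + (powRes k p n ∩ {a | p ∣ a}).ncard := by
  have := Set.ncard_inter_add_ncard_sdiff_eq_ncard (powRes k p n) {a | p ∣ a} (powRes_finite k p n)
  rw [← this, add_comm]
  rfl

lemma powRes_formula (k : ℕ) (hk : 1 ≤ k) (p : ℕ) (hp : p.Prime) (hpk : ¬ p ∣ k)
    (r : ℕ) (hr1 : 1 ≤ r) (hr2 : r ≤ k) (n : ℕ) : ∀ (_ : 1 ≤ n) (_ : n % k = r % k),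
    (powRes k p n).ncard * (Nat.gcd k (p - 1) * (p ^ k - 1)) =
      (p ^ (n + k - 1) - p ^ (r - 1)) * (p - 1) + Nat.gcd k (p - 1) * (p ^ k - 1) := by
  induction n using Nat.strong_induction_on with
  | _ n ih =>
  intro hn hnr
  have hU := card_units_part k p n hk hp hpk hn
  have hS := ncard_split k p n
  rcases le_or_gt n k with hnk | hnk
  · have hrn : n = r := by
      rcases hnk.lt_or_eq with h | h <;> rcases hr2.lt_or_eq with h' | h'
      · rwa [Nat.mod_eq_of_lt h, Nat.mod_eq_of_lt h'] at hnr
      · rw [Nat.mod_eq_of_lt h, h', Nat.mod_self] at hnr; omega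
      · rw [Nat.mod_eq_of_lt h', h, Nat.mod_self] at hnr; omega
      · omega
    subst hrn
    rw [nonunit_small k p n hk hp hn hnk, Set.ncard_singleton] at hS
    have : p ^ (n + k - 1) - p ^ (n - 1) = p ^ (n - 1) * (p ^ k - 1) := by
      rw [Nat.mul_sub, ← pow_add, mul_one]; congr 2; omega
    rw [hS, this, add_mul, one_mul, ← mul_assoc, hU]
    ring
  · obtain ⟨m, rfl⟩ : ∃ m, n = m + k := ⟨n - k, by omega⟩
    have h := ih m (by omega) (by omega) (by simpa using hnr)
    rw [nonunit_large k p m hk hp (by omega), Set.ncard_image_of_injective _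
      (fun a b hab => Nat.eq_of_mul_eq_mul_left (pow_pos hp.pos k) hab)] at hS
    rw [hS, add_mul, h, ← mul_assoc, hU]
    have e : p ^ (m + k + k - 1) - p ^ (r - 1) =
        p ^ (m + k - 1) * (p ^ k - 1) + (p ^ (m + k - 1) - p ^ (r - 1)) := by
      have h1 : p ^ (m + k + k - 1) = p ^ (m + k - 1) * p ^ k := by
        rw [← pow_add]; congr 1; omega
      have h2 : p ^ (r - 1) ≤ p ^ (m + k - 1) := Nat.pow_le_pow_right hp.pos (by omega)
      have h3 : p ^ (m + k - 1) ≤ p ^ (m + k - 1) * p ^ k :=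
        Nat.le_mul_of_pos_right _ (pow_pos hp.pos k)
      rw [h1, Nat.mul_sub, mul_one]; omega
    rw [e]; ring


/-- explicit formula for `α(pⁿ)` for the polynomial `x^k`, stated
in denominator-cleared form:
`α(pⁿ) · d · (p^k − 1) = (p^{n+k−1} − p^{r−1}) · (p − 1) + d · (p^k − 1)`,
where `d = gcd(k, p−1)` and `n ≡ r (mod k)` with `1 ≤ r ≤ k`. -/
theorem alpha_pow_k_formula (k : ℕ) (hk : 1 ≤ k) (p : ℕ) (hp : p.Prime)
    (hpk : ¬ p ∣ k) (d : ℕ) (hd : d = Nat.gcd k (p - 1))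
    (n r : ℕ) (hn : 1 ≤ n) (hr1 : 1 ≤ r) (hr2 : r ≤ k) (hnr : n % k = r % k) :
    Set.ncard {a : ℕ | a < p ^ n ∧
        ∃ x : ℤ, x ^ k ≡ (a : ℤ) [ZMOD ((p : ℤ) ^ n)]} * (d * (p ^ k - 1)) =
      (p ^ (n + k - 1) - p ^ (r - 1)) * (p - 1) + d * (p ^ k - 1) := by
  subst hd
  exact powRes_formula k hk p hp hpk r hr1 hr2 n hn hnr
end

section
/- For every integer n ≥ 1, the number of residues a ∈ {0,1,…,2^n−1} such that the congruence x² + y² ≡ a (mod 2^n) is solvable in integers equals 2^{n−1} + 1. -/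
lemma sq_lift (a : ℤ) (ha : a % 8 = 1) (n : ℕ) :
    ∃ x k : ℤ, x % 2 = 1 ∧ x ^ 2 = a + 2 ^ (n + 3) * k := by
  induction n with
  | zero => exact ⟨1, -(a / 8), by norm_num, by norm_num; omega⟩
  | succ n ih =>
    obtain ⟨x, k, hx, h⟩ := ih
    obtain ⟨t, rfl⟩ : ∃ t, x = 2 * t + 1 := ⟨x / 2, by omega⟩
    refine ⟨2 * t + 1 + 2 ^ (n + 2) * k, k * (t + 1) + 2 ^ n * k ^ 2, ?_, ?_⟩
    · have : (2 : ℤ) ^ (n + 2) * k = 2 * (2 ^ (n + 1) * k) := by ring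
      omega
    · linear_combination h

lemma two_sq_lift (a : ℤ) (ha : a % 4 = 1) (n : ℕ) :
    ∃ x y : ℤ, x ^ 2 + y ^ 2 ≡ a [ZMOD ((2 : ℤ) ^ n)] := by
  have key : ∀ b : ℤ, b % 8 = 1 → ∃ x : ℤ, x ^ 2 ≡ b [ZMOD ((2 : ℤ) ^ n)] := by
    intro b hb
    obtain ⟨x, k, -, h⟩ := sq_lift b hb n
    refine ⟨x, ?_⟩
    rw [Int.modEq_comm, Int.modEq_iff_dvd]
    exact ⟨8 * k, by rw [h]; ring⟩
  have : a % 8 = 1 ∨ (a - 4) % 8 = 1 := by omega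
  rcases this with h | h
  · obtain ⟨x, hx⟩ := key a h
    exact ⟨x, 0, by simpa using hx⟩
  · obtain ⟨x, hx⟩ := key _ h
    exact ⟨x, 2, by have := hx.add_right (2 ^ 2); norm_num at this ⊢; exact this⟩

lemma S_step (m : ℕ) :
    {a : ℕ | a < 2 ^ (m + 2) ∧
        ∃ x y : ℤ, x ^ 2 + y ^ 2 ≡ (a : ℤ) [ZMOD ((2 : ℤ) ^ (m + 2))]} =
    (fun b : ℕ => 2 * b) '' {a : ℕ | a < 2 ^ (m + 1) ∧
        ∃ x y : ℤ, x ^ 2 + y ^ 2 ≡ (a : ℤ) [ZMOD ((2 : ℤ) ^ (m + 1))]} ∪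
    (fun k : ℕ => 4 * k + 1) '' (Finset.range (2 ^ m) : Set ℕ) := by
  have e1 : 2 ^ (m + 2) = 4 * 2 ^ m := by ring
  have e2 : 2 ^ (m + 1) = 2 * 2 ^ m := by ring
  have e1' : (2 : ℤ) ^ (m + 2) = 4 * 2 ^ m := by ring
  have e2' : (2 : ℤ) ^ (m + 1) = 2 * 2 ^ m := by ring
  ext a
  simp only [Set.mem_union, Set.mem_image, Set.mem_ofPred_eq, Finset.coe_range, Set.mem_Iio]
  constructor
  · rintro ⟨ha, x, y, h⟩
    obtain ⟨c, hc⟩ := h.dvd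
    rw [e1', mul_assoc] at hc
    rcases Int.even_or_odd' x with ⟨u, rfl | rfl⟩ <;> rcases Int.even_or_odd' y with ⟨v, rfl | rfl⟩
    · left
      have h4 : (a : ℤ) = 2 * (2 * (u ^ 2 + v ^ 2) + 2 * (2 ^ m * c)) := by linear_combination hc
      refine ⟨a / 2, ⟨by omega, u + v, u - v, ?_⟩, by omega⟩
      rw [Int.modEq_iff_dvd]
      refine ⟨c, ?_⟩
      have : ((a / 2 : ℕ) : ℤ) = 2 * (u ^ 2 + v ^ 2) + 2 * (2 ^ m * c) := by omega
      rw [this]; ring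
    · right
      have h4 : (a : ℤ) = 4 * (u ^ 2 + v ^ 2 + v + 2 ^ m * c) + 1 := by linear_combination hc
      exact ⟨a / 4, by omega, by omega⟩
    · right
      have h4 : (a : ℤ) = 4 * (u ^ 2 + v ^ 2 + u + 2 ^ m * c) + 1 := by linear_combination hc
      exact ⟨a / 4, by omega, by omega⟩
    · left
      have h4 : (a : ℤ) = 2 * (2 * (u ^ 2 + v ^ 2 + u + v) + 1 + 2 * (2 ^ m * c)) := by
        linear_combination hc
      refine ⟨a / 2, ⟨by omega, u + v + 1, u - v, ?_⟩, by omega⟩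
      rw [Int.modEq_iff_dvd]
      refine ⟨c, ?_⟩
      have : ((a / 2 : ℕ) : ℤ) = 2 * (u ^ 2 + v ^ 2 + u + v) + 1 + 2 * (2 ^ m * c) := by omega
      rw [this]; ring
  · rintro (⟨b, ⟨hb, x, y, h⟩, rfl⟩ | ⟨k, hk, rfl⟩)
    · refine ⟨by omega, x + y, x - y, ?_⟩
      obtain ⟨c, hc⟩ := h.dvd
      rw [Int.modEq_iff_dvd]
      refine ⟨c, ?_⟩
      push_cast
      linear_combination 2 * hc
    · exact ⟨by omega, two_sq_lift _ (by push_cast; omega) _⟩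

/-- for `n ≥ 1`, the number of residues `a ∈ {0,…,2ⁿ−1}` such
that `x² + y² ≡ a (mod 2ⁿ)` is solvable equals `2ⁿ⁻¹ + 1`. -/
theorem alpha_two_squares_two_pow (n : ℕ) (hn : 1 ≤ n) :
    Set.ncard {a : ℕ | a < 2 ^ n ∧
        ∃ x y : ℤ, x ^ 2 + y ^ 2 ≡ (a : ℤ) [ZMOD ((2 : ℤ) ^ n)]} = 2 ^ (n - 1) + 1 := by
  obtain ⟨m, rfl⟩ : ∃ m, n = m + 1 := ⟨n - 1, by omega⟩
  clear hn
  rw [Nat.add_sub_cancel]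
  induction m with
  | zero =>
    have : {a : ℕ | a < 2 ^ (0 + 1) ∧
        ∃ x y : ℤ, x ^ 2 + y ^ 2 ≡ (a : ℤ) [ZMOD ((2 : ℤ) ^ (0 + 1))]} = {0, 1} := by
      ext a
      simp only [Set.mem_ofPred_eq, Set.mem_insert_iff, Set.mem_singleton_iff]
      constructor
      · rintro ⟨h, -⟩
        omega
      · rintro (rfl | rfl)
        · exact ⟨by norm_num, 0, 0, by norm_num⟩
        · exact ⟨by norm_num, 1, 0, by norm_num⟩
    rw [this, Set.ncard_pair (by norm_num)]
    norm_num
  | succ m ih =>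
    rw [S_step m, Set.ncard_union_eq ?_ ?_ ?_, Set.ncard_image_of_injective, Set.ncard_image_of_injective,
      ih, Set.ncard_coe_finset, Finset.card_range]
    · ring
    · intro a b h
      simp only at h
      omega
    · intro a b h
      simp only at h
      omega
    · rw [Set.disjoint_left]
      rintro _ ⟨b, -, rfl⟩ ⟨k, -, h⟩
      simp only at h
      omega
    · exact ((Set.finite_lt_nat (2 ^ (m + 1))).subset (fun a h => h.1)).image _
    · exact (Finset.finite_toSet _).image _
end

section
/- Let p be a prime with p ≡ 3 (mod 4) and let n ≥ 1. Then the number of residues a ∈ {0,1,…,p^n−1} such that x² + y² ≡ a (mod p^n) is solvable equals p·(p^n + 1)/(p+1) when n is odd, and (p^{n+1} + 1)/(p+1) when n is even. -/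
def RepSq (p n : ℕ) (a : ℤ) : Prop :=
  ∃ x y : ℤ, x ^ 2 + y ^ 2 ≡ a [ZMOD ((p : ℤ) ^ n)]

lemma repSq_hensel (p : ℕ) (hp : p.Prime) (h : p % 4 = 3) (n : ℕ) (hn : 1 ≤ n) (a x y : ℤ)
    (hx : ¬ (p : ℤ) ∣ x) (hxy : x ^ 2 + y ^ 2 ≡ a [ZMOD ((p : ℤ) ^ n)]) :
    RepSq p (n + 1) a := by
  obtain ⟨k, hk⟩ := hxy.dvd
  have hpi : Prime (p : ℤ) := Nat.prime_iff_prime_int.mp hp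
  have h2 : ¬ (p : ℤ) ∣ 2 * x := by
    intro hd
    rcases hpi.dvd_or_dvd hd with h' | h'
    · have : p ∣ 2 := by exact_mod_cast h'
      have := Nat.le_of_dvd (by norm_num) this
      have := hp.two_le
      omega
    · exact hx h'
  have hc : IsCoprime (p : ℤ) (2 * x) := (hpi.irreducible.coprime_iff_not_dvd).2 h2
  obtain ⟨u, v, huv⟩ := hc
  obtain ⟨m, rfl⟩ : ∃ m, n = m + 1 := ⟨n - 1, by omega⟩
  refine ⟨x + p ^ (m + 1) * (v * k), y, ?_⟩
  apply Int.modEq_of_dvd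
  refine ⟨k * u - p ^ m * (v * k) ^ 2, ?_⟩
  have ha : a = x ^ 2 + y ^ 2 + p ^ (m + 1) * k := by linarith
  rw [ha]
  linear_combination (-(p : ℤ) ^ (m + 1) * k) * huv

lemma repSq_unit (p : ℕ) (hp : p.Prime) (h : p % 4 = 3) (n : ℕ) (a : ℤ)
    (ha : ¬ (p : ℤ) ∣ a) : RepSq p n a := by
  induction n with
  | zero => exact ⟨0, 0, by simp [Int.modEq_one]⟩
  | succ n ih =>
    rcases Nat.eq_zero_or_pos n with rfl | hn
    · haveI := Fact.mk hp
      obtain ⟨x, y, hxy⟩ := ZMod.sq_add_sq p (a : ZMod p)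
      refine ⟨x.val, y.val, ?_⟩
      have : (((x.val : ℤ) ^ 2 + (y.val : ℤ) ^ 2 : ℤ) : ZMod p) = (a : ZMod p) := by
        push_cast
        simpa using hxy
      simpa using (ZMod.intCast_eq_intCast_iff _ _ _).1 this
    · obtain ⟨x, y, hxy⟩ := ih
      by_cases hx : (p : ℤ) ∣ x
      · by_cases hy : (p : ℤ) ∣ y
        · exfalso
          apply ha
          have h1 : (p : ℤ) ∣ a - (x ^ 2 + y ^ 2) :=
            (dvd_pow_self _ (by omega)).trans hxy.dvd
          have h2 : (p : ℤ) ∣ x ^ 2 + y ^ 2 :=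
            dvd_add (dvd_pow hx two_ne_zero) (dvd_pow hy two_ne_zero)
          simpa using dvd_add h1 h2
        · exact repSq_hensel p hp h n hn a y x hy (by rwa [add_comm])
      · exact repSq_hensel p hp h n hn a x y hx hxy

lemma dvd_of_sq_add_sq (p : ℕ) (hp : p.Prime) (h : p % 4 = 3) (x y : ℤ)
    (hd : (p : ℤ) ∣ x ^ 2 + y ^ 2) : (p : ℤ) ∣ x := by
  haveI := Fact.mk hp
  by_contra hx
  have hx0 : (x : ZMod p) ≠ 0 := by
    rwa [Ne, ZMod.intCast_zmod_eq_zero_iff_dvd]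
  have h0 : (x : ZMod p) ^ 2 + (y : ZMod p) ^ 2 = 0 := by
    have := (ZMod.intCast_zmod_eq_zero_iff_dvd (x ^ 2 + y ^ 2) p).2 hd
    push_cast at this
    exact this
  exact ZMod.mod_four_ne_three_of_sq_eq_neg_sq' hx0 (eq_neg_of_add_eq_zero_right h0) h

lemma repSq_mul (p : ℕ) (hp : p.Prime) (n : ℕ) (b : ℤ) (hb : RepSq p n b) :
    RepSq p (n + 2) (p ^ 2 * b) := by
  obtain ⟨x, y, hxy⟩ := hb
  obtain ⟨k, hk⟩ := hxy.dvd
  refine ⟨p * x, p * y, Int.modEq_of_dvd ⟨k, ?_⟩⟩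
  linear_combination (p : ℤ) ^ 2 * hk

lemma repSq_dvd (p : ℕ) (hp : p.Prime) (h : p % 4 = 3) (n : ℕ) (a : ℤ) (ha : (p : ℤ) ∣ a)
    (hr : RepSq p (n + 2) a) : ∃ b, a = p ^ 2 * b ∧ RepSq p n b := by
  obtain ⟨x, y, hxy⟩ := hr
  obtain ⟨k, hk⟩ := hxy.dvd
  have hd : (p : ℤ) ∣ x ^ 2 + y ^ 2 := by
    have : x ^ 2 + y ^ 2 = a - p * (p ^ (n + 1) * k) := by linear_combination -hk
    rw [this]
    exact dvd_sub ha (dvd_mul_right _ _)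
  obtain ⟨u, rfl⟩ := dvd_of_sq_add_sq p hp h x y hd
  obtain ⟨v, rfl⟩ := dvd_of_sq_add_sq p hp h y (p * u) (by rwa [add_comm])
  refine ⟨u ^ 2 + v ^ 2 + p ^ n * k, by linear_combination hk, u, v, ?_⟩
  exact Int.modEq_of_dvd ⟨k, by ring⟩

def repSet (p n : ℕ) : Set ℕ := {a : ℕ | a < p ^ n ∧ RepSq p n a}

lemma repSet_step (p : ℕ) (hp : p.Prime) (h : p % 4 = 3) (n : ℕ) :
    repSet p (n + 2) = (((Finset.range (p ^ (n + 2))).filter (p ^ (n + 2)).Coprime : Finset ℕ) :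
      Set ℕ) ∪ (fun b => p ^ 2 * b) '' repSet p n := by
  have hcop : ∀ a : ℕ, (p ^ (n + 2)).Coprime a ↔ ¬ p ∣ a := fun a => by
    rw [Nat.coprime_pow_left_iff (by omega), hp.coprime_iff_not_dvd]
  have hp2 : 0 < p ^ 2 := pow_pos hp.pos 2
  ext a
  simp only [repSet, Set.mem_setOf_eq, Set.mem_union, Finset.coe_filter, Finset.mem_range,
    Set.mem_image, hcop]
  constructor
  · rintro ⟨hlt, hr⟩
    by_cases hd : p ∣ a
    · right
      obtain ⟨b, hb, hrb⟩ := repSq_dvd p hp h n a (by exact_mod_cast hd) hr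
      have hb0 : 0 ≤ b := by
        have h1 : (0 : ℤ) ≤ p ^ 2 * b := hb ▸ Int.natCast_nonneg a
        have h2 : (0 : ℤ) < p ^ 2 := by exact_mod_cast hp2
        exact nonneg_of_mul_nonneg_right h1 h2
      lift b to ℕ using hb0
      have hab : a = p ^ 2 * b := by exact_mod_cast hb
      refine ⟨b, ⟨?_, hrb⟩, hab.symm⟩
      rw [hab, pow_add, mul_comm] at hlt
      exact lt_of_mul_lt_mul_right hlt (Nat.zero_le _)
    · exact Or.inl ⟨hlt, hd⟩
  · rintro (⟨hlt, hd⟩ | ⟨b, ⟨hlt, hr⟩, rfl⟩)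
    · exact ⟨hlt, repSq_unit p hp h _ _ (by exact_mod_cast hd)⟩
    · refine ⟨?_, ?_⟩
      · rw [pow_add, mul_comm]
        exact Nat.mul_lt_mul_of_pos_right hlt hp2
      · have := repSq_mul p hp n b hr
        push_cast
        exact this

lemma repSet_card_step (p : ℕ) (hp : p.Prime) (h : p % 4 = 3) (n : ℕ) :
    (repSet p (n + 2)).ncard = p ^ (n + 1) * (p - 1) + (repSet p n).ncard := by
  have hfin : (repSet p n).Finite := (Set.finite_lt_nat (p ^ n)).subset fun a ha => ha.1
  have hp2 : 0 < p ^ 2 := pow_pos hp.pos 2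
  rw [repSet_step p hp h n, Set.ncard_union_eq _ (Finset.finite_toSet _) (hfin.image _),
    Set.ncard_coe_finset, Set.ncard_image_of_injective]
  · congr 1
    exact Nat.totient_prime_pow_succ hp (n + 1)
  · intro a b hab
    exact Nat.eq_of_mul_eq_mul_left hp2 hab
  · rw [Set.disjoint_left]
    rintro a ha ⟨b, -, rfl⟩
    simp only [Finset.coe_filter, Set.mem_setOf_eq] at ha
    have h1 := (Nat.coprime_pow_left_iff (by omega) _ _).1 ha.2
    rw [hp.coprime_iff_not_dvd] at h1
    exact h1 ((dvd_pow_self p two_ne_zero).mul_right b)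

lemma repSet_card_zero (p : ℕ) : (repSet p 0).ncard = 1 := by
  have : repSet p 0 = {0} := by
    ext a
    simp only [repSet, Set.mem_setOf_eq, pow_zero, Nat.lt_one_iff, Set.mem_singleton_iff]
    exact ⟨fun h => h.1, fun h => ⟨h, 0, 0, by simp [Int.modEq_one]⟩⟩
  rw [this, Set.ncard_singleton]

lemma repSet_card_one (p : ℕ) (hp : p.Prime) (h : p % 4 = 3) : (repSet p 1).ncard = p := by
  have : repSet p 1 = ((Finset.range p : Finset ℕ) : Set ℕ) := by
    ext a
    simp only [repSet, Set.mem_setOf_eq, pow_one, Finset.coe_range, Set.mem_Iio]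
    refine ⟨fun h => h.1, fun hlt => ⟨hlt, ?_⟩⟩
    by_cases hd : p ∣ a
    · refine ⟨0, 0, Int.modEq_of_dvd ?_⟩
      simpa using (by exact_mod_cast hd : (p : ℤ) ∣ a)
    · exact repSq_unit p hp h _ _ (by exact_mod_cast hd)
  rw [this, Set.ncard_coe_finset, Finset.card_range]

lemma repSet_card_even (p : ℕ) (hp : p.Prime) (h : p % 4 = 3) (k : ℕ) :
    (repSet p (2 * k)).ncard * (p + 1) = p ^ (2 * k + 1) + 1 := by
  induction k with
  | zero => simp [repSet_card_zero]
  | succ k ih =>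
    rw [show 2 * (k + 1) = 2 * k + 2 by ring, repSet_card_step p hp h, add_mul, ih]
    obtain ⟨q, rfl⟩ : ∃ q, p = q + 1 := ⟨p - 1, by have := hp.pos; omega⟩
    simp only [Nat.add_sub_cancel]
    ring

lemma repSet_card_odd (p : ℕ) (hp : p.Prime) (h : p % 4 = 3) (k : ℕ) :
    (repSet p (2 * k + 1)).ncard * (p + 1) = p * (p ^ (2 * k + 1) + 1) := by
  induction k with
  | zero => simp [repSet_card_one p hp h]
  | succ k ih =>
    rw [show 2 * (k + 1) + 1 = 2 * k + 1 + 2 by ring, repSet_card_step p hp h, add_mul, ih]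
    obtain ⟨q, rfl⟩ : ∃ q, p = q + 1 := ⟨p - 1, by have := hp.pos; omega⟩
    simp only [Nat.add_sub_cancel]
    ring

/-- for a prime `p ≡ 3 (mod 4)` and `n ≥ 1`, the number of
residues `a ∈ {0,…,pⁿ−1}` with `x² + y² ≡ a (mod pⁿ)` solvable equals
`p(pⁿ+1)/(p+1)` for odd `n` and `(pⁿ⁺¹+1)/(p+1)` for even `n`
(stated in denominator-cleared form). -/
theorem alpha_two_squares_p3mod4 (p : ℕ) (hp : p.Prime) (h : p % 4 = 3)
    (n : ℕ) (hn : 1 ≤ n) :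
    (Odd n → Set.ncard {a : ℕ | a < p ^ n ∧
        ∃ x y : ℤ, x ^ 2 + y ^ 2 ≡ (a : ℤ) [ZMOD ((p : ℤ) ^ n)]} * (p + 1) =
      p * (p ^ n + 1)) ∧
    (Even n → Set.ncard {a : ℕ | a < p ^ n ∧
        ∃ x y : ℤ, x ^ 2 + y ^ 2 ≡ (a : ℤ) [ZMOD ((p : ℤ) ^ n)]} * (p + 1) =
      p ^ (n + 1) + 1) := by
  constructor
  · rintro ⟨k, rfl⟩
    exact repSet_card_odd p hp h k
  · rintro ⟨k, rfl⟩
    rw [← two_mul]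
    exact repSet_card_even p hp h k
end

section
/- For every integer n ≥ 1, the number of residues a ∈ {0,1,…,2^n−1} such that the congruence x² + y² + z² ≡ a (mod 2^n) is solvable in integers equals (5·2^{n−1} + 1)/3 when n is odd, and 2·(5·2^{n−2} + 1)/3 when n is even. -/
lemma sq_lift_s13 (c : ℤ) (hc : c % 8 = 1) (m : ℕ) :
    ∃ x : ℤ, x % 2 = 1 ∧ (2 : ℤ) ^ (m + 3) ∣ c - x ^ 2 := by
  induction m with
  | zero => exact ⟨1, by norm_num, by norm_num; omega⟩
  | succ m ih =>
    obtain ⟨x, hx, k, hk⟩ := ih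
    rcases Int.even_or_odd' k with ⟨j, rfl | rfl⟩
    · exact ⟨x, hx, j, by rw [hk]; ring⟩
    · obtain ⟨t, ht⟩ : ∃ t, x = 2 * t + 1 := ⟨x / 2, by omega⟩
      refine ⟨x + 2 ^ (m + 2), ?_, j - t - 2 ^ m, ?_⟩
      · rw [pow_succ]; omega
      · have : c = x ^ 2 + 2 ^ (m + 3) * (2 * j + 1) := by linarith
        rw [this, ht]; ring

def Solv (n : ℕ) (a : ℤ) : Prop :=
  ∃ x y z : ℤ, x ^ 2 + y ^ 2 + z ^ 2 ≡ a [ZMOD ((2 : ℤ) ^ n)]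

lemma solv_of (n : ℕ) (a : ℤ)
    (h : a % 8 = 1 ∨ a % 8 = 2 ∨ a % 8 = 3 ∨ a % 8 = 5 ∨ a % 8 = 6) : Solv n a := by
  have key : ∀ y z : ℤ, (a - y ^ 2 - z ^ 2) % 8 = 1 → Solv n a := by
    intro y z h1
    obtain ⟨x, -, hx⟩ := sq_lift_s13 _ h1 n
    refine ⟨x, y, z, Int.modEq_iff_dvd.2 ?_⟩
    have := (pow_dvd_pow (2 : ℤ) (Nat.le_add_right n 3)).trans hx
    rwa [show a - (x ^ 2 + y ^ 2 + z ^ 2) = a - y ^ 2 - z ^ 2 - x ^ 2 by ring]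
  rcases h with h | h | h | h | h
  · exact key 0 0 (by omega)
  · exact key 1 0 (by omega)
  · exact key 1 1 (by omega)
  · exact key 2 0 (by omega)
  · exact key 2 1 (by omega)

lemma sq_mod8 (x : ℤ) : (x ^ 2 % 8 = 1 ∧ x % 2 = 1) ∨ (x ^ 2 % 8 = 0 ∧ x % 2 = 0) ∨
    (x ^ 2 % 8 = 4 ∧ x % 2 = 0) := by
  have h : x % 8 = 0 ∨ x % 8 = 1 ∨ x % 8 = 2 ∨ x % 8 = 3 ∨ x % 8 = 4 ∨ x % 8 = 5 ∨
    x % 8 = 6 ∨ x % 8 = 7 := by omega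
  rcases h with h | h | h | h | h | h | h | h <;> simp [pow_two, Int.mul_emod, h] <;> omega

lemma solv_iff (n : ℕ) (hn : 1 ≤ n) (a : ℤ) : Solv (n + 2) a ↔
    (a % 8 = 1 ∨ a % 8 = 2 ∨ a % 8 = 3 ∨ a % 8 = 5 ∨ a % 8 = 6) ∨
      ∃ b, a = 4 * b ∧ Solv n b := by
  constructor
  · rintro ⟨x, y, z, h⟩
    have hd := Int.modEq_iff_dvd.1 h
    have h8 : (8 : ℤ) ∣ a - (x ^ 2 + y ^ 2 + z ^ 2) :=
      (pow_dvd_pow (2 : ℤ) (show 3 ≤ n + 2 by omega)).trans hd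
    have hx := sq_mod8 x
    have hy := sq_mod8 y
    have hz := sq_mod8 z
    by_cases h4 : a % 4 = 0
    · right
      obtain ⟨b, rfl⟩ : ∃ b, a = 4 * b := ⟨a / 4, by omega⟩
      obtain ⟨x, rfl⟩ : ∃ b, x = 2 * b := ⟨x / 2, by omega⟩
      obtain ⟨y, rfl⟩ : ∃ b, y = 2 * b := ⟨y / 2, by omega⟩
      obtain ⟨z, rfl⟩ : ∃ b, z = 2 * b := ⟨z / 2, by omega⟩
      refine ⟨b, rfl, x, y, z, Int.modEq_iff_dvd.2 ?_⟩
      obtain ⟨k, hk⟩ := hd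
      refine ⟨k, ?_⟩
      rw [pow_add] at hk
      linarith
    · left; omega
  · rintro (h | ⟨b, rfl, x, y, z, h⟩)
    · exact solv_of _ _ h
    · obtain ⟨k, hk⟩ := Int.modEq_iff_dvd.1 h
      refine ⟨2 * x, 2 * y, 2 * z, Int.modEq_iff_dvd.2 ⟨k, ?_⟩⟩
      rw [pow_add]
      linarith

def good (a : ℕ) : Prop := a % 8 = 1 ∨ a % 8 = 2 ∨ a % 8 = 3 ∨ a % 8 = 5 ∨ a % 8 = 6

instance : DecidablePred good := fun a => by unfold good; infer_instance

lemma count_good (k : ℕ) : Nat.count good (8 * k) = 5 * k := by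
  induction k with
  | zero => simp
  | succ k ih =>
    rw [Nat.mul_succ, Nat.count_add, ih]
    have : Nat.count (fun j => good (8 * k + j)) 8 = 5 := by
      simp [Nat.count_succ, good, Nat.add_mod]
    rw [this]; ring

def S (n : ℕ) : Set ℕ := {a : ℕ | a < 2 ^ n ∧ Solv n a}

lemma S_fin (n : ℕ) : (S n).Finite := (Set.finite_lt_nat (2 ^ n)).subset fun _ h => h.1

lemma S_rec (n : ℕ) (hn : 1 ≤ n) : (S (n + 2)).ncard = 5 * 2 ^ (n - 1) + (S n).ncard := by
  have h8 : 2 ^ (n + 2) = 8 * 2 ^ (n - 1) := by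
    obtain ⟨m, rfl⟩ := Nat.exists_eq_add_of_le' hn
    simp only [Nat.add_sub_cancel]; ring
  have hS : S (n + 2) = (((Finset.range (8 * 2 ^ (n - 1))).filter good : Finset ℕ) : Set ℕ) ∪
      (fun b => 4 * b) '' S n := by
    ext a
    simp only [S, Set.mem_ofPred_eq, solv_iff n hn, Set.mem_union, Finset.coe_filter,
      Finset.mem_range, Set.mem_image, ← h8, good]
    constructor
    · rintro ⟨h, h1 | ⟨b, hb, h1⟩⟩
      · left; exact ⟨h, by omega⟩
      · right
        refine ⟨a / 4, ⟨by rw [pow_add] at h; omega, ?_⟩, by omega⟩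
        have : ((a / 4 : ℕ) : ℤ) = b := by omega
        rwa [this]
    · rintro (⟨h, h1⟩ | ⟨b, ⟨h, h1⟩, rfl⟩)
      · exact ⟨h, Or.inl (by omega)⟩
      · exact ⟨by rw [pow_add]; omega, Or.inr ⟨b, by push_cast; rfl, h1⟩⟩
  rw [hS, Set.ncard_union_eq _ (Finset.finite_toSet _) ((S_fin n).image _), Set.ncard_coe_finset,
    ← Nat.count_eq_card_filter_range, count_good, Set.ncard_image_of_injective]
  · intro a b h; simpa using h
  · rw [Set.disjoint_left]
    rintro a ha ⟨b, -, rfl⟩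
    simp only [Finset.coe_filter, Set.mem_ofPred_eq, good] at ha
    omega

lemma S_small (n : ℕ) (h : ∀ a < 2 ^ n, Solv n (a : ℕ)) : (S n).ncard = 2 ^ n := by
  have : S n = (Finset.range (2 ^ n) : Finset ℕ) := by
    ext a
    simp only [S, Set.mem_ofPred_eq, Finset.coe_range, Set.mem_Iio]
    exact ⟨fun h => h.1, fun ha => ⟨ha, h a ha⟩⟩
  rw [this, Set.ncard_coe_finset, Finset.card_range]

lemma S_small' (n : ℕ) (hn : n ≤ 2) : (S n).ncard = 2 ^ n := by
  refine S_small n fun a ha => ?_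
  have : 2 ^ n ≤ 2 ^ 2 := Nat.pow_le_pow_right (by norm_num) hn
  by_cases h0 : a = 0
  · subst h0; exact ⟨0, 0, 0, by simp⟩
  · exact solv_of _ _ (by omega)

lemma S_odd (k : ℕ) : 3 * (S (2 * k + 1)).ncard = 5 * 2 ^ (2 * k) + 1 := by
  induction k with
  | zero => rw [S_small' _ (by norm_num)]; norm_num
  | succ k ih =>
    rw [show 2 * (k + 1) + 1 = 2 * k + 1 + 2 by ring, S_rec _ (by omega), mul_add, ih,
      Nat.add_sub_cancel]
    ring

lemma S_even (k : ℕ) : 3 * (S (2 * k + 2)).ncard = 2 * (5 * 2 ^ (2 * k) + 1) := by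
  induction k with
  | zero => rw [S_small' _ (by norm_num)]; norm_num
  | succ k ih =>
    rw [show 2 * (k + 1) + 2 = 2 * k + 2 + 2 by ring, S_rec _ (by omega), mul_add, ih,
      show 2 * k + 2 - 1 = 2 * k + 1 by omega]
    ring


/-- for `n ≥ 1`, the number of residues `a ∈ {0,…,2ⁿ−1}` with
`x² + y² + z² ≡ a (mod 2ⁿ)` solvable equals `(5·2ⁿ⁻¹+1)/3` for odd `n` and
`2(5·2ⁿ⁻²+1)/3` for even `n` (stated in denominator-cleared form). -/
theorem alpha_three_squares_two_pow (n : ℕ) (hn : 1 ≤ n) :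
    (Odd n → 3 * Set.ncard {a : ℕ | a < 2 ^ n ∧
        ∃ x y z : ℤ, x ^ 2 + y ^ 2 + z ^ 2 ≡ (a : ℤ) [ZMOD ((2 : ℤ) ^ n)]} =
      5 * 2 ^ (n - 1) + 1) ∧
    (Even n → 3 * Set.ncard {a : ℕ | a < 2 ^ n ∧
        ∃ x y z : ℤ, x ^ 2 + y ^ 2 + z ^ 2 ≡ (a : ℤ) [ZMOD ((2 : ℤ) ^ n)]} =
      2 * (5 * 2 ^ (n - 2) + 1)) := by

  constructor
  · rintro ⟨k, rfl⟩
    exact S_odd k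
  · rintro ⟨k, rfl⟩
    obtain ⟨m, rfl⟩ := Nat.exists_eq_add_of_le' (show 1 ≤ k by omega)
    have h := S_even m
    rw [show m + 1 + (m + 1) = 2 * m + 2 by ring, Nat.add_sub_cancel]
    exact h
end

section
/- Let p be an odd prime and let m be an integer that is a sum of three squares of integers. Then there exists an integer c such that p·m − c·p² is a sum of three squares of integers. -/
/-- if `p` is an odd prime and `m` is a sum of three squares,
then there exists an integer `c` such that `p·m − c·p²` is a sum of three
squares. -/
theorem pm_sub_cp_sq_three_squares (p : ℕ) (hp : p.Prime) (hodd : Odd p)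
    (m : ℤ) (hm : ∃ a b c : ℤ, m = a ^ 2 + b ^ 2 + c ^ 2) :
    ∃ c : ℤ, ∃ u v w : ℤ,
      (p : ℤ) * m - c * (p : ℤ) ^ 2 = u ^ 2 + v ^ 2 + w ^ 2 := by
  have := Fact.mk hp
  obtain ⟨a, b, k, -, -, h⟩ := Int.exists_sq_add_sq_add_one_eq_mul p
  obtain ⟨q, hq⟩ := hodd
  have h' : (a : ℤ) ^ 2 + (b : ℤ) ^ 2 + 1 = k * p := by exact_mod_cast h
  have hq' : (p : ℤ) = 2 * q + 1 := by exact_mod_cast hq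
  refine ⟨-(m - k + ((q + 1) * (m - k)) ^ 2), a, b, 1 + (q + 1) * (m - k) * p, ?_⟩
  linear_combination (-1 : ℤ) * h' + (p : ℤ) * (m - k) * hq'
end

section
/- For a positive integer n, the congruence x² + y² + z² ≡ a (mod n) is solvable in integers for every residue a ∈ {0,1,…,n−1} if and only if n is not divisible by 8. Equivalently, the polynomial x² + y² + z² is surjective as a map (ℤ/nℤ)³ → ℤ/nℤ if and only if n ≢ 0 (mod 8). -/
/-- Every integer is a sum of three squares modulo `n`. -/
def SurjThree (n : ℕ) : Prop :=
  ∀ a : ℤ, ∃ x y z : ℤ, x ^ 2 + y ^ 2 + z ^ 2 ≡ a [ZMOD (n : ℤ)]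

lemma surjThree_mul {m n : ℕ} (h : Nat.Coprime m n) (hm : SurjThree m) (hn : SurjThree n) :
    SurjThree (m * n) := by
  intro a
  obtain ⟨x, y, z, h1⟩ := hm a
  obtain ⟨x', y', z', h2⟩ := hn a
  obtain ⟨u, v, huv⟩ := Nat.isCoprime_iff_coprime.mpr h
  have key : ∀ s t : ℤ, ∃ r : ℤ, r ≡ s [ZMOD (m : ℤ)] ∧ r ≡ t [ZMOD (n : ℤ)] := by
    intro s t
    refine ⟨s * (v * n) + t * (u * m), ?_, ?_⟩
    · refine (Int.modEq_iff_dvd.mpr ⟨u * (s - t), ?_⟩)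
      linear_combination (-s) * huv
    · refine (Int.modEq_iff_dvd.mpr ⟨v * (t - s), ?_⟩)
      linear_combination (-t) * huv
  obtain ⟨X, hX, hX'⟩ := key x x'
  obtain ⟨Y, hY, hY'⟩ := key y y'
  obtain ⟨Z, hZ, hZ'⟩ := key z z'
  refine ⟨X, Y, Z, ?_⟩
  push_cast
  refine (Int.modEq_and_modEq_iff_modEq_mul (by simpa using h)).mp ⟨?_, ?_⟩
  · exact (((hX.pow 2).add (hY.pow 2)).add (hZ.pow 2)).trans h1
  · exact (((hX'.pow 2).add (hY'.pow 2)).add (hZ'.pow 2)).trans h2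

lemma lift_sq {p : ℕ} (hp : p.Prime) (hp2 : p ≠ 2) {x b : ℤ} (hx : ¬ (p : ℤ) ∣ x)
    (h : (p : ℤ) ∣ x ^ 2 - b) (k : ℕ) :
    ∃ w : ℤ, ¬ (p : ℤ) ∣ w ∧ (p : ℤ) ^ (k + 1) ∣ w ^ 2 - b := by
  have hpi : Prime (p : ℤ) := Nat.prime_iff_prime_int.mp hp
  induction k with
  | zero => exact ⟨x, hx, by simpa using h⟩
  | succ k ih =>
    obtain ⟨w, hw, m, hm⟩ := ih
    have h2 : ¬ (p : ℤ) ∣ 2 * w := by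
      intro hd
      rcases hpi.dvd_or_dvd hd with h' | h'
      · have : p ∣ 2 := by exact_mod_cast h'
        exact hp2 ((Nat.prime_dvd_prime_iff_eq hp Nat.prime_two).mp this)
      · exact hw h'
    obtain ⟨u, v, huv⟩ := (hpi.irreducible.coprime_iff_not_dvd).mpr h2
    refine ⟨w + p ^ (k + 1) * (-m * v), ?_, ?_⟩
    · intro hd
      apply hw
      have h3 : (p : ℤ) ∣ p ^ (k + 1) * (-m * v) :=
        Dvd.dvd.mul_right (dvd_pow_self _ (by omega)) _
      exact (dvd_add_left h3).mp hd
    · refine ⟨m * u + p ^ k * (m * v) ^ 2, ?_⟩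
      linear_combination hm - (p : ℤ) ^ (k + 1) * m * huv

lemma surjThree_odd_pow {p : ℕ} (hp : p.Prime) (hp2 : p ≠ 2) (k : ℕ) :
    SurjThree (p ^ (k + 1)) := by
  intro a
  have hpi : Prime (p : ℤ) := Nat.prime_iff_prime_int.mp hp
  haveI : Fact p.Prime := ⟨hp⟩
  obtain ⟨z, hz⟩ : ∃ z : ℤ, ¬ (p : ℤ) ∣ a - z ^ 2 := by
    by_cases h : (p : ℤ) ∣ a
    · refine ⟨1, fun h' => hpi.not_dvd_one ?_⟩
      have := dvd_sub h h'
      simpa using this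
    · exact ⟨0, by simpa using h⟩
  obtain ⟨x, y, -, -, hxy⟩ := Nat.sq_add_sq_zmodEq p (a - z ^ 2)
  have main : ∀ x y : ℤ, x ^ 2 + y ^ 2 ≡ a - z ^ 2 [ZMOD p] → ¬ (p : ℤ) ∣ x →
      ∃ x y z : ℤ, x ^ 2 + y ^ 2 + z ^ 2 ≡ a [ZMOD ((p ^ (k + 1) : ℕ) : ℤ)] := by
    intro x y h hx
    obtain ⟨w, -, hw⟩ := lift_sq hp hp2 (b := a - z ^ 2 - y ^ 2) hx
      (by have := h.symm.dvd; convert this using 1; ring) k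
    refine ⟨w, y, z, (Int.modEq_iff_dvd.mpr ?_).symm⟩
    push_cast
    convert hw using 1; ring
  by_cases hx : (p : ℤ) ∣ x
  · refine main y x (by rw [add_comm]; exact hxy) ?_
    intro hy
    apply hz
    have h1 := hxy.dvd
    have h2 : (p : ℤ) ∣ (x : ℤ) ^ 2 + (y : ℤ) ^ 2 :=
      dvd_add (dvd_pow hx two_ne_zero) (dvd_pow hy two_ne_zero)
    have := dvd_add h1 h2
    simpa using this
  · exact main x y hxy hx

lemma surjThree_four : SurjThree 4 := by
  intro a
  have : a % 4 = 0 ∨ a % 4 = 1 ∨ a % 4 = 2 ∨ a % 4 = 3 := by omega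
  rcases this with h | h | h | h
  · exact ⟨0, 0, 0, by simp [Int.ModEq, h]⟩
  · exact ⟨1, 0, 0, by simp [Int.ModEq, h]⟩
  · exact ⟨1, 1, 0, by simp [Int.ModEq, h]⟩
  · exact ⟨1, 1, 1, by simp [Int.ModEq, h]⟩

lemma surjThree_of_dvd {m n : ℕ} (h : m ∣ n) (hn : SurjThree n) : SurjThree m := by
  intro a
  obtain ⟨x, y, z, h1⟩ := hn a
  exact ⟨x, y, z, h1.of_dvd (by exact_mod_cast h)⟩

lemma surjThree_of_not_dvd (n : ℕ) : 0 < n → ¬ 8 ∣ n → SurjThree n := by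
  induction n using Nat.recOnPosPrimePosCoprime with
  | prime_pow p k hp hk =>
    intro _ h8
    by_cases hp2 : p = 2
    · subst hp2
      have hk3 : k < 3 := by
        by_contra hc
        exact h8 (pow_dvd_pow 2 (show 3 ≤ k by omega))
      exact surjThree_of_dvd (pow_dvd_pow 2 (show k ≤ 2 by omega)) surjThree_four
    · obtain ⟨j, rfl⟩ : ∃ j, k = j + 1 := ⟨k - 1, by omega⟩
      exact surjThree_odd_pow hp hp2 j
  | zero => intro h; omega
  | one => exact fun _ _ => surjThree_of_dvd (one_dvd 4) surjThree_four
  | coprime a b ha hb hab iha ihb =>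
    intro _ h8
    exact surjThree_mul hab
      (iha (by omega) fun h => h8 (h.mul_right b)) (ihb (by omega) fun h => h8 (h.mul_left a))

lemma not_seven (x y z : ℤ) : ¬ x ^ 2 + y ^ 2 + z ^ 2 ≡ 7 [ZMOD 8] := by
  intro h
  have h1 := (ZMod.intCast_eq_intCast_iff _ _ 8).mpr h
  push_cast at h1
  have : ∀ x y z : ZMod 8, x ^ 2 + y ^ 2 + z ^ 2 ≠ 7 := by decide
  exact this _ _ _ h1

lemma zmod_iff (n : ℕ) :
    (∀ a : ZMod n, ∃ x y z : ZMod n, x ^ 2 + y ^ 2 + z ^ 2 = a) ↔ SurjThree n := by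
  constructor
  · intro h a
    obtain ⟨x, y, z, h1⟩ := h a
    obtain ⟨x, rfl⟩ := ZMod.intCast_surjective x
    obtain ⟨y, rfl⟩ := ZMod.intCast_surjective y
    obtain ⟨z, rfl⟩ := ZMod.intCast_surjective z
    exact ⟨x, y, z, (ZMod.intCast_eq_intCast_iff _ _ n).mp (by push_cast; exact h1)⟩
  · intro h a
    obtain ⟨a, rfl⟩ := ZMod.intCast_surjective a
    obtain ⟨x, y, z, h1⟩ := h a
    have := (ZMod.intCast_eq_intCast_iff _ _ n).mpr h1
    push_cast at this
    exact ⟨x, y, z, this⟩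

/-- `x² + y² + z²` is surjective mod `n` iff `8 ∤ n`. -/
theorem three_squares_surjective_iff (n : ℕ) (hn : 0 < n) :
    ((∀ a : ℕ, a < n →
        ∃ x y z : ℤ, x ^ 2 + y ^ 2 + z ^ 2 ≡ (a : ℤ) [ZMOD (n : ℤ)]) ↔ ¬ (8 ∣ n)) ∧
    ((∀ a : ZMod n, ∃ x y z : ZMod n, x ^ 2 + y ^ 2 + z ^ 2 = a) ↔ ¬ (8 ∣ n)) := by
  have hneg : 8 ∣ n → ¬ ∃ x y z : ℤ, x ^ 2 + y ^ 2 + z ^ 2 ≡ ((7 : ℕ) : ℤ) [ZMOD (n : ℤ)] := by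
    rintro h ⟨x, y, z, h1⟩
    exact not_seven x y z (h1.of_dvd (by exact_mod_cast h))
  rw [zmod_iff]
  refine ⟨⟨fun h h8 => hneg h8 (h 7 ?_), fun h a _ => surjThree_of_not_dvd n hn h a⟩,
    ⟨fun h h8 => hneg h8 (h _), surjThree_of_not_dvd n hn⟩⟩
  have := Nat.le_of_dvd hn h8
  omega
end

section
/- Let n ≥ 2. A residue a ∈ {0,1,…,2^n−1} satisfies x² − y² ≡ a (mod 2^n) for some integers x, y if and only if a is not of the form 4k+2 (i.e., a ≢ 2 (mod 4)). Consequently, the number of residues a ∈ {0,1,…,2^n−1} for which x² − y² ≡ a (mod 2^n) is solvable equals 3·2^{n−2}. -/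
lemma card_aux (m : ℕ) : ((Finset.range (4 * m)).filter (fun a => a % 4 ≠ 2)).card = 3 * m := by
  induction m with
  | zero => simp
  | succ k ih =>
    have h0 : (4 * k) % 4 ≠ 2 := by omega
    have h1 : (4 * k + 1) % 4 ≠ 2 := by omega
    have h2 : ¬ ((4 * k + 2) % 4 ≠ 2) := by omega
    have h3 : (4 * k + 3) % 4 ≠ 2 := by omega
    have e : 4 * (k + 1) = 4 * k + 1 + 1 + 1 + 1 := by ring
    rw [e, Finset.range_add_one, Finset.range_add_one, Finset.range_add_one,
      Finset.range_add_one, Finset.filter_insert, if_pos h3, Finset.filter_insert, if_neg h2,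
      Finset.filter_insert, if_pos h1, Finset.filter_insert, if_pos h0,
      Finset.card_insert_of_notMem (by simp), Finset.card_insert_of_notMem (by simp),
      Finset.card_insert_of_notMem (by simp), ih]
    ring

lemma iff_aux (n : ℕ) (hn : 2 ≤ n) (a : ℕ) :
    (∃ x y : ℤ, x ^ 2 - y ^ 2 ≡ (a : ℤ) [ZMOD ((2 : ℤ) ^ n)]) ↔ a % 4 ≠ 2 := by
  constructor
  · rintro ⟨x, y, h⟩ ha
    have h4 : (4 : ℤ) ∣ 2 ^ n := by
      have := pow_dvd_pow (2 : ℤ) hn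
      norm_num at this
      exact this
    have h' : (x ^ 2 - y ^ 2) % 4 = (a : ℤ) % 4 := h.of_dvd h4
    have sq : ∀ z : ℤ, z ^ 2 % 4 = 0 ∨ z ^ 2 % 4 = 1 := by
      intro z
      rcases Int.even_or_odd' z with ⟨c, rfl | rfl⟩
      · left; ring_nf; omega
      · right; ring_nf; omega
    rcases sq x with hx | hx <;> rcases sq y with hy | hy <;> omega
  · intro ha
    have h3 : a % 4 = 0 ∨ a % 2 = 1 := by omega
    rcases h3 with h | h
    · obtain ⟨k, rfl⟩ : ∃ k, a = 4 * k := ⟨a / 4, by omega⟩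
      refine ⟨k + 1, k - 1, ?_⟩
      have : ((k : ℤ) + 1) ^ 2 - (k - 1) ^ 2 = ((4 * k : ℕ) : ℤ) := by push_cast; ring
      rw [this]
    · obtain ⟨k, rfl⟩ : ∃ k, a = 2 * k + 1 := ⟨a / 2, by omega⟩
      refine ⟨k + 1, k, ?_⟩
      have : ((k : ℤ) + 1) ^ 2 - k ^ 2 = ((2 * k + 1 : ℕ) : ℤ) := by push_cast; ring
      rw [this]


/-- for `n ≥ 2`, a residue `a ∈ {0,…,2ⁿ−1}` is a difference of
two squares mod `2ⁿ` iff `a ≢ 2 (mod 4)`; consequently `α(2ⁿ) = 3·2ⁿ⁻²`. -/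
theorem diff_two_squares_two_pow (n : ℕ) (hn : 2 ≤ n) :
    (∀ a : ℕ, a < 2 ^ n →
      ((∃ x y : ℤ, x ^ 2 - y ^ 2 ≡ (a : ℤ) [ZMOD ((2 : ℤ) ^ n)]) ↔ a % 4 ≠ 2)) ∧
    Set.ncard {a : ℕ | a < 2 ^ n ∧
        ∃ x y : ℤ, x ^ 2 - y ^ 2 ≡ (a : ℤ) [ZMOD ((2 : ℤ) ^ n)]} = 3 * 2 ^ (n - 2) := by

  refine ⟨fun a _ => iff_aux n hn a, ?_⟩
  have e : {a : ℕ | a < 2 ^ n ∧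
        ∃ x y : ℤ, x ^ 2 - y ^ 2 ≡ (a : ℤ) [ZMOD ((2 : ℤ) ^ n)]} =
      ((Finset.range (4 * 2 ^ (n - 2))).filter (fun a => a % 4 ≠ 2) : Finset ℕ) := by
    have hp : 4 * 2 ^ (n - 2) = 2 ^ n := by
      obtain ⟨k, rfl⟩ := Nat.exists_eq_add_of_le hn
      rw [Nat.add_sub_cancel_left, pow_add]
      norm_num
    ext a
    simp only [Set.mem_setOf_eq, Finset.coe_filter, Finset.mem_range, hp, iff_aux n hn a]
  rw [e, Set.ncard_coe_finset, card_aux]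
end
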